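/- For every Markov policy ρ over horizon H ≥ 1, every 0 ≤ n < H, every x̂ ∈ X̂ and every q ∈ Q with q ∉ F, writing û := ρ_{H−n−1}(x̂,q), one has: 1 − V̲^ρ_{n+1}(x̂,q) = (1−δ) · ∑_{x̃ ∈ X̂'_{−ε}(q)} (1 − max_{q' ∈ Q'_ε(q,x̃)} V̲^ρ_n(x̃,q')) · T̂ x̂ û x̃ (identity (A.2) of Lemma A.1 of the paper). -/

import Mathlib

set_option autoImplicit false

open Finset MeasureTheory

attribute [local instance] Classical.propDecidable

noncomputable section

variable {p : ℕ} {X Xh A Q U : Type*}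

/-- The set `Q'_ε(q, x̂')` of DFA successor states compatible with
the abstract state `x̂'` up to output precision `ε`. -/
def Qeps (h : X → EuclideanSpace ℝ (Fin p)) (hh : Xh → EuclideanSpace ℝ (Fin p))
    (L : EuclideanSpace ℝ (Fin p) → A) (τ : Q → A → Q) (ε : ℝ) [Fintype Q]
    (q : Q) (x' : Xh) : Finset Q :=
  Finset.univ.filter fun q' => ∃ x : X, q' = τ q (L (h x)) ∧ ‖h x - hh x'‖ ≤ ε

lemma Qeps_nonempty (h : X → EuclideanSpace ℝ (Fin p)) (hh : Xh → EuclideanSpace ℝ (Fin p))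
    (L : EuclideanSpace ℝ (Fin p) → A) (τ : Q → A → Q) (ε : ℝ) [Fintype Q]
    (hcov : ∀ x' : Xh, ∃ x : X, ‖h x - hh x'‖ ≤ ε) (q : Q) (x' : Xh) :
    (Qeps h hh L τ ε q x').Nonempty := by
  obtain ⟨x, hx⟩ := hcov x'
  exact ⟨τ q (L (h x)), Finset.mem_filter.2 ⟨Finset.mem_univ _, ⟨x, rfl, hx⟩⟩⟩

/-- Robust cost-to-go functions `V̄^ρ_n` for a Markov policy `ρ` over horizon `H`. -/
def Vbar [Fintype Q] [Fintype Xh]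
    (h : X → EuclideanSpace ℝ (Fin p)) (hh : Xh → EuclideanSpace ℝ (Fin p))
    (L : EuclideanSpace ℝ (Fin p) → A) (τ : Q → A → Q) (ε : ℝ)
    (hQ : ∀ (q : Q) (x' : Xh), (Qeps h hh L τ ε q x').Nonempty)
    (That : Xh → U → Xh → ℝ) (F : Set Q) (δ : ℝ) (H : ℕ) (ρ : ℕ → Xh × Q → U) :
    ℕ → Xh × Q → ℝ
  | 0, s => if s.2 ∈ F then 1 else 0
  | n + 1, s =>
      if s.2 ∈ F then 1
      else (1 - δ) * ∑ x' : Xh,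
        ((Qeps h hh L τ ε s.2 x').inf' (hQ s.2 x')
          fun q' => Vbar h hh L τ ε hQ That F δ H ρ n (x', q'))
        * That s.1 (ρ (H - n - 1) s) x'

/-- Violation cost-to-go functions `V̲^ρ_n` for a Markov policy `ρ` over horizon `H`. -/
def Vunder [Fintype Q] [Fintype Xh]
    (h : X → EuclideanSpace ℝ (Fin p)) (hh : Xh → EuclideanSpace ℝ (Fin p))
    (L : EuclideanSpace ℝ (Fin p) → A) (τ : Q → A → Q) (ε : ℝ)
    (hQ : ∀ (q : Q) (x' : Xh), (Qeps h hh L τ ε q x').Nonempty)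
    (That : Xh → U → Xh → ℝ) (F : Set Q) (δ : ℝ) (H : ℕ) (ρ : ℕ → Xh × Q → U) :
    ℕ → Xh × Q → ℝ
  | 0, s => if s.2 ∈ F then 1 else 0
  | n + 1, s =>
      if s.2 ∈ F then 1
      else (1 - δ) * (∑ x' : Xh,
        ((Qeps h hh L τ ε s.2 x').sup' (hQ s.2 x')
          fun q' => Vunder h hh L τ ε hQ That F δ H ρ n (x', q'))
        * That s.1 (ρ (H - n - 1) s) x') + δ

/-- The set `X̂'_{−ε}(q)` of abstract states all of whose related concrete states have
non-accepting DFA successor from `q`. -/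
def Xmeps (h : X → EuclideanSpace ℝ (Fin p)) (hh : Xh → EuclideanSpace ℝ (Fin p))
    (L : EuclideanSpace ℝ (Fin p) → A) (τ : Q → A → Q) (F : Set Q) (ε : ℝ)
    [Fintype Xh] (q : Q) : Finset Xh :=
  Finset.univ.filter fun xh => ∀ x : X, ‖h x - hh xh‖ ≤ ε → τ q (L (h x)) ∉ F

lemma Vunder_le_one [Fintype Q] [Fintype Xh]
    (h : X → EuclideanSpace ℝ (Fin p)) (hh : Xh → EuclideanSpace ℝ (Fin p))
    (L : EuclideanSpace ℝ (Fin p) → A) (τ : Q → A → Q) (ε : ℝ)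
    (hQ : ∀ (q : Q) (x' : Xh), (Qeps h hh L τ ε q x').Nonempty)
    (That : Xh → U → Xh → ℝ) (F : Set Q) (δ : ℝ) (H : ℕ) (ρ : ℕ → Xh × Q → U)
    (hδ1 : δ ≤ 1)
    (hT0 : ∀ xh u xh', 0 ≤ That xh u xh')
    (hT1 : ∀ xh u, ∑ xh' : Xh, That xh u xh' = 1) (n : ℕ) :
    ∀ s, Vunder h hh L τ ε hQ That F δ H ρ n s ≤ 1 := by
  induction n with
  | zero =>
    intro s
    rw [Vunder]
    split_ifs <;> norm_num
  | succ n ih =>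
    intro s
    rw [Vunder]
    split_ifs
    · exact le_rfl
    · have key : (∑ x' : Xh,
        ((Qeps h hh L τ ε s.2 x').sup' (hQ s.2 x')
          fun q' => Vunder h hh L τ ε hQ That F δ H ρ n (x', q'))
        * That s.1 (ρ (H - n - 1) s) x') ≤ 1 := by
        rw [← hT1 s.1 (ρ (H - n - 1) s)]
        refine Finset.sum_le_sum fun x' _ => ?_
        refine mul_le_of_le_one_left (hT0 _ _ _) ?_
        exact Finset.sup'_le _ _ fun q' _ => ih _
      have := mul_le_mul_of_nonneg_left key (sub_nonneg.2 hδ1)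
      linarith

lemma Vunder_of_mem [Fintype Q] [Fintype Xh]
    (h : X → EuclideanSpace ℝ (Fin p)) (hh : Xh → EuclideanSpace ℝ (Fin p))
    (L : EuclideanSpace ℝ (Fin p) → A) (τ : Q → A → Q) (ε : ℝ)
    (hQ : ∀ (q : Q) (x' : Xh), (Qeps h hh L τ ε q x').Nonempty)
    (That : Xh → U → Xh → ℝ) (F : Set Q) (δ : ℝ) (H : ℕ) (ρ : ℕ → Xh × Q → U)
    (n : ℕ) (s : Xh × Q) (hs : s.2 ∈ F) :
    Vunder h hh L τ ε hQ That F δ H ρ n s = 1 := by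
  cases n <;> rw [Vunder, if_pos hs]

theorem statement11
    (hp : 1 ≤ p) [Nonempty X] [Fintype Xh] [Nonempty Xh] [Fintype A] [Fintype Q]
    [Fintype U] [Nonempty U]
    (h : X → EuclideanSpace ℝ (Fin p)) (hh : Xh → EuclideanSpace ℝ (Fin p))
    (L : EuclideanSpace ℝ (Fin p) → A) (τ : Q → A → Q) (F : Set Q)
    (ε δ : ℝ) (hε : 0 ≤ ε) (hδ0 : 0 ≤ δ) (hδ1 : δ ≤ 1)
    (hcov : ∀ x' : Xh, ∃ x : X, ‖h x - hh x'‖ ≤ ε)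
    (That : Xh → U → Xh → ℝ)
    (hT0 : ∀ xh u xh', 0 ≤ That xh u xh')
    (hT1 : ∀ xh u, ∑ xh' : Xh, That xh u xh' = 1)
    (H : ℕ) (hH : 1 ≤ H) (ρ : ℕ → Xh × Q → U) (n : ℕ) (hn : n < H)
    (xh : Xh) (q : Q) (hq : q ∉ F) :
    1 - Vunder h hh L τ ε (Qeps_nonempty h hh L τ ε hcov) That F δ H ρ (n + 1) (xh, q) =
      (1 - δ) * ∑ xt ∈ Xmeps h hh L τ F ε q,
        (1 - (Qeps h hh L τ ε q xt).sup' (Qeps_nonempty h hh L τ ε hcov q xt)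
          (fun q' => Vunder h hh L τ ε (Qeps_nonempty h hh L τ ε hcov) That F δ H ρ n (xt, q')))
        * That xh (ρ (H - n - 1) (xh, q)) xt := by
  have hsub : ∑ xt ∈ Xmeps h hh L τ F ε q,
        (1 - (Qeps h hh L τ ε q xt).sup' (Qeps_nonempty h hh L τ ε hcov q xt)
          (fun q' => Vunder h hh L τ ε (Qeps_nonempty h hh L τ ε hcov) That F δ H ρ n (xt, q')))
        * That xh (ρ (H - n - 1) (xh, q)) xt = ∑ xt : Xh,
        (1 - (Qeps h hh L τ ε q xt).sup' (Qeps_nonempty h hh L τ ε hcov q xt)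
          (fun q' => Vunder h hh L τ ε (Qeps_nonempty h hh L τ ε hcov) That F δ H ρ n (xt, q')))
        * That xh (ρ (H - n - 1) (xh, q)) xt := by
    refine Finset.sum_subset (Finset.subset_univ _) fun xt _ hxt => ?_
    have hex : ∃ x : X, ‖h x - hh xt‖ ≤ ε ∧ τ q (L (h x)) ∈ F := by
      by_contra hcon
      push Not at hcon
      exact hxt (Finset.mem_filter.2 ⟨Finset.mem_univ _, hcon⟩)
    obtain ⟨x, hx, hxF⟩ := hex
    have h1 : (Qeps h hh L τ ε q xt).sup' (Qeps_nonempty h hh L τ ε hcov q xt)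
          (fun q' => Vunder h hh L τ ε (Qeps_nonempty h hh L τ ε hcov) That F δ H ρ n (xt, q'))
          = 1 := by
      apply le_antisymm
      · exact Finset.sup'_le _ _ fun q' _ => Vunder_le_one _ _ _ _ _ _ _ _ _ _ _ hδ1 hT0 hT1 _ _
      · have hm : τ q (L (h x)) ∈ Qeps h hh L τ ε q xt :=
          Finset.mem_filter.2 ⟨Finset.mem_univ _, ⟨x, rfl, hx⟩⟩
        refine le_trans (le_of_eq ?_) (Finset.le_sup' _ hm)
        exact (Vunder_of_mem h hh L τ ε _ That F δ H ρ n (xt, τ q (L (h x))) hxF).symm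
    rw [h1]
    ring
  rw [hsub, Vunder, if_neg hq]
  simp only [sub_mul, one_mul, Finset.sum_sub_distrib, hT1]
  ring

end
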